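/- arXiv:math/0610984 — 7 statements merged into one kernel-verified Lean document; each statement's English description precedes it below -/
import Mathlib

section
/- Let P be a labeled poset. Then the set of all P-partitions is the disjoint union, over all linear extensions π of P, of the sets of π-partitions: A(P;S) = ⨆_{π ∈ L(P)} A(π;S), i.e., every P-partition f : P → S is a π-partition for exactly one linear extension π of P, and conversely every π-partition for π ∈ L(P) is a P-partition. -/
/-- A labeled poset: a finite set of (distinct) positive integers
together with a strict partial order on them. -/
structure LabeledPoset where
  carrier : Finset ℕ+
  lt : ℕ+ → ℕ+ → Prop
  mem_of_lt : ∀ {a b}, lt a b → a ∈ carrier ∧ b ∈ carrier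
  lt_irrefl : ∀ a, ¬ lt a a
  lt_trans : ∀ {a b c}, lt a b → lt b c → lt a c

/-- The strict total order determined by a list: `a` occurs (strictly) before `b`. -/
def chainRel {α : Type*} (l : List α) (a b : α) : Prop :=
  ∃ i j : Fin l.length, i < j ∧ l.get i = a ∧ l.get j = b

/-- `π` is a linear extension of the poset whose elements are given by the
predicate `mem` and whose order is `r`: it lists each element exactly once and
its total order refines `r`. -/
def IsLinearExtension {α : Type*} (mem : α → Prop) (r : α → α → Prop) (π : List α) : Prop :=
  π.Nodup ∧ (∀ x, x ∈ π ↔ mem x) ∧ ∀ a b, r a b → chainRel π a b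

/-- `f` is a `P`-partition for the strict order `r` on the carrier `c`:
`f i ≤ f j` whenever `i <_P j`, and `f i < f j` whenever `i <_P j` and `i > j`
as positive integers. -/
def IsPPartition {S : Type*} [Preorder S] {c : Finset ℕ+} (r : ℕ+ → ℕ+ → Prop)
    (f : {x // x ∈ c} → S) : Prop :=
  ∀ a b : {x // x ∈ c}, r a.1 b.1 → f a ≤ f b ∧ ((b : ℕ+) < (a : ℕ+) → f a < f b)

/-- The strict total order on labels induced by `f` with ties broken by labels. -/
def keyRel {S : Type*} [LinearOrder S] {c : Finset ℕ+} (f : {x // x ∈ c} → S)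
    (x y : ℕ+) : Prop :=
  ∃ (hx : x ∈ c) (hy : y ∈ c), f ⟨x, hx⟩ < f ⟨y, hy⟩ ∨ (f ⟨x, hx⟩ = f ⟨y, hy⟩ ∧ x < y)

theorem keyRel_asymm {S : Type*} [LinearOrder S] {c : Finset ℕ+} (f : {x // x ∈ c} → S)
    (x y : ℕ+) (h : keyRel f x y) (h' : keyRel f y x) : x = y := by
  obtain ⟨hx, hy, h⟩ := h
  obtain ⟨_, _, h'⟩ := h'
  exfalso
  rcases h with h | ⟨h, hl⟩ <;> rcases h' with h' | ⟨h', hl'⟩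
  · exact lt_asymm h h'
  · exact h.ne h'.symm
  · exact h'.ne h.symm
  · exact lt_asymm hl hl'

theorem pairwise_iff_chainRel {α : Type*} (R : α → α → Prop) (l : List α) :
    l.Pairwise R ↔ ∀ a b, chainRel l a b → R a b := by
  rw [List.pairwise_iff_get]
  constructor
  · rintro h a b ⟨i, j, hij, rfl, rfl⟩
    exact h i j hij
  · intro h i j hij
    exact h _ _ ⟨i, j, hij, rfl, rfl⟩

theorem isPPartition_iff_pairwise {S : Type*} [LinearOrder S] {c : Finset ℕ+}
    (f : {x // x ∈ c} → S) (l : List ℕ+) (hn : l.Nodup) (hm : ∀ x, x ∈ l ↔ x ∈ c) :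
    IsPPartition (chainRel l) f ↔ l.Pairwise (keyRel f) := by
  rw [pairwise_iff_chainRel]
  constructor
  · rintro h a b hab
    have hne : a ≠ b := (pairwise_iff_chainRel _ _).1 hn a b hab
    have hab' := hab
    obtain ⟨i, j, hij, hi, hj⟩ := hab'
    have ha : a ∈ c := (hm a).1 (hi ▸ List.get_mem _ _)
    have hb : b ∈ c := (hm b).1 (hj ▸ List.get_mem _ _)
    refine ⟨ha, hb, ?_⟩
    obtain ⟨h1, h2⟩ := h ⟨a, ha⟩ ⟨b, hb⟩ hab
    rcases lt_or_gt_of_ne hne with hlt | hgt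
    · rcases h1.lt_or_eq with h1 | h1
      · exact Or.inl h1
      · exact Or.inr ⟨h1, hlt⟩
    · exact Or.inl (h2 hgt)
  · intro h a b hab
    obtain ⟨_, _, h⟩ := h _ _ hab
    rcases h with h | ⟨h, hl⟩
    · exact ⟨h.le, fun _ => h⟩
    · exact ⟨h.le, fun h' => absurd h' (lt_asymm hl)⟩

theorem chainRel_total {α : Type*} (l : List α) {a b : α} (ha : a ∈ l) (hb : b ∈ l)
    (hne : a ≠ b) : chainRel l a b ∨ chainRel l b a := by
  obtain ⟨i, rfl⟩ := List.get_of_mem ha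
  obtain ⟨j, rfl⟩ := List.get_of_mem hb
  rcases lt_trichotomy i j with h | h | h
  · exact Or.inl ⟨i, j, h, rfl, rfl⟩
  · exact absurd (by rw [h]) hne
  · exact Or.inr ⟨j, i, h, rfl, rfl⟩

/-- The labels sorted by the order `keyRel f`. -/
theorem exists_sorted {S : Type*} [LinearOrder S] {c : Finset ℕ+} (f : {x // x ∈ c} → S) :
    ∃ l : List ℕ+, l.Nodup ∧ (∀ x, x ∈ l ↔ x ∈ c) ∧ l.Pairwise (keyRel f) := by
  let k : {x // x ∈ c} → S ×ₗ ℕ+ := fun x => toLex (f x, x.1)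
  let L := (c.attach.image k).sort (· ≤ ·)
  have hL : ∀ z, z ∈ L ↔ ∃ x, k x = z := by intro z; simp [L]
  have hs : L.Pairwise (· < ·) := (Finset.sortedLT_sort _).pairwise
  have hp : (L.map (fun z => (ofLex z).2)).Pairwise (keyRel f) := by
    rw [List.pairwise_map]
    refine hs.imp_of_mem ?_
    intro a b ha hb hab
    obtain ⟨x, rfl⟩ := (hL a).1 ha
    obtain ⟨y, rfl⟩ := (hL b).1 hb
    exact ⟨x.2, y.2, Prod.Lex.toLex_lt_toLex.1 hab⟩
  refine ⟨_, ?_, ?_, hp⟩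
  · refine hp.imp ?_
    rintro a b ⟨_, _, h⟩ rfl
    rcases h with h | h
    · exact lt_irrefl _ h
    · exact lt_irrefl _ h.2
  · intro x
    rw [List.mem_map]
    constructor
    · rintro ⟨z, hz, rfl⟩
      obtain ⟨y, rfl⟩ := (hL z).1 hz
      exact y.2
    · intro hx
      exact ⟨k ⟨x, hx⟩, (hL _).2 ⟨_, rfl⟩, rfl⟩

/-- The set of all `P`-partitions `A(P;S)` is the disjoint union over all linear
extensions `π ∈ L(P)` of the sets of `π`-partitions `A(π;S)`. -/
theorem statement0 (P : LabeledPoset) (S : Type*) [LinearOrder S] [Countable S] :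
    ({f : {x // x ∈ P.carrier} → S | IsPPartition P.lt f} =
      ⋃ π ∈ {π : List ℕ+ | IsLinearExtension (· ∈ P.carrier) P.lt π},
        {f : {x // x ∈ P.carrier} → S | IsPPartition (chainRel π) f}) ∧
    ∀ π ∈ {π : List ℕ+ | IsLinearExtension (· ∈ P.carrier) P.lt π},
      ∀ π' ∈ {π : List ℕ+ | IsLinearExtension (· ∈ P.carrier) P.lt π}, π ≠ π' →
        Disjoint {f : {x // x ∈ P.carrier} → S | IsPPartition (chainRel π) f}
          {f : {x // x ∈ P.carrier} → S | IsPPartition (chainRel π') f} := by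
  constructor
  · ext f
    simp only [Set.mem_setOf_eq, Set.mem_iUnion, exists_prop]
    constructor
    · intro hf
      obtain ⟨l, hn, hm, hp⟩ := exists_sorted f
      refine ⟨l, ⟨hn, hm, ?_⟩, (isPPartition_iff_pairwise f l hn hm).2 hp⟩
      intro a b hab
      obtain ⟨ha, hb⟩ := P.mem_of_lt hab
      have hne : a ≠ b := by
        rintro rfl
        exact P.lt_irrefl _ hab
      rcases chainRel_total l ((hm a).2 ha) ((hm b).2 hb) hne with h | h
      · exact h
      · exfalso
        obtain ⟨h1, h2⟩ := hf ⟨a, ha⟩ ⟨b, hb⟩ hab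
        obtain ⟨_, _, h3⟩ := (pairwise_iff_chainRel _ _).1 hp _ _ h
        rcases h3 with h3 | ⟨h3, h4⟩
        · exact absurd h3 (not_lt.2 h1)
        · exact (h2 h4).ne h3.symm
    · rintro ⟨l, ⟨_, _, hr⟩, hf⟩ a b hab
      exact hf a b (hr _ _ hab)
  · rintro l ⟨hn, hm, _⟩ l' ⟨hn', hm', _⟩ hne
    rw [Set.disjoint_left]
    intro f hf hf'
    apply hne
    have h1 := (isPPartition_iff_pairwise f l hn hm).1 hf
    have h2 := (isPPartition_iff_pairwise f l' hn' hm').1 hf'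
    have hperm : l.Perm l' := (List.perm_ext_iff_of_nodup hn hn').2
      fun x => (hm x).trans (hm' x).symm
    exact hperm.eq_of_pairwise (fun a b _ _ => keyRel_asymm f a b) h1 h2
end

section
/- For any labeled poset P, the generating function for P-partitions satisfies Γ(P) = Σ_{π ∈ L(P)} Γ(π), as an identity of formal power series in x₁, x₂, …. -/
/-- The generating function `Σ_f Π_i x_{v(f i)}` over all maps `f : ι → A`
satisfying `cond`: the coefficient of a monomial `d` is the number of such `f`
for which, for every variable index `s`, the number of `i` with `v (f i) = s`
is the exponent `d s`. -/
noncomputable def genGF {ι A σ : Type*} (cond : (ι → A) → Prop) (v : A → σ) :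
    MvPowerSeries σ ℚ :=
  fun d => (Nat.card {f : ι → A // cond f ∧ ∀ s : σ, Nat.card {i : ι // v (f i) = s} = d s} : ℚ)

lemma aux_finite_ext (c : Finset ℕ+) (r : ℕ+ → ℕ+ → Prop) :
    {π : List ℕ+ | IsLinearExtension (· ∈ c) r π}.Finite := by
  refine (c.toList.permutations.toFinset.finite_toSet).subset ?_
  rintro π ⟨h1, h2, -⟩
  simp only [Finset.mem_coe, List.mem_toFinset, List.mem_permutations]
  refine (List.perm_ext_iff_of_nodup h1 c.nodup_toList).2 fun a => ?_
  simp [h2 a]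

lemma aux_finite_fun {c : Finset ℕ+} (cond : ({x // x ∈ c} → ℕ+) → Prop) (d : ℕ+ →₀ ℕ) :
    Finite {f : {x // x ∈ c} → ℕ+ //
      cond f ∧ ∀ s : ℕ+, Nat.card {i : {x // x ∈ c} // id (f i) = s} = d s} := by
  have : (Set.univ.pi (fun _ : {x // x ∈ c} => (d.support : Set ℕ+))).Finite :=
    Set.Finite.pi fun _ => d.support.finite_toSet
  refine (this.subset ?_).to_subtype
  rintro f ⟨-, hf⟩ i -
  simp only [Finset.mem_coe, Finsupp.mem_support_iff, ← hf]
  have : Nonempty {j : {x // x ∈ c} // id (f j) = f i} := ⟨⟨i, rfl⟩⟩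
  exact ne_of_gt Nat.card_pos

/-- The sorting key of an element, refining the values of `f` by the labels. -/
noncomputable def auxKey {c : Finset ℕ+} (f : {x // x ∈ c} → ℕ+) (x : ℕ+) : ℕ+ ×ₗ ℕ+ :=
  toLex (if h : x ∈ c then f ⟨x, h⟩ else 1, x)

lemma auxKey_inj {c : Finset ℕ+} (f : {x // x ∈ c} → ℕ+) : Function.Injective (auxKey f) := by
  intro a b h
  simpa [auxKey] using congrArg (fun p => (ofLex p).2) h

lemma auxKey_lt {c : Finset ℕ+} (f : {x // x ∈ c} → ℕ+) (a b : {x // x ∈ c}) (hab : a ≠ b) :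
    auxKey f a < auxKey f b ↔ f a ≤ f b ∧ ((b : ℕ+) < (a : ℕ+) → f a < f b) := by
  have hab' : (a : ℕ+) ≠ b := fun h => hab (Subtype.ext h)
  simp only [auxKey, Prod.Lex.toLex_lt_toLex, a.2, b.2, dif_pos]
  constructor
  · rintro (h | ⟨h, h'⟩)
    · exact ⟨h.le, fun _ => h⟩
    · exact ⟨h.le, fun h'' => absurd h' h''.not_gt⟩
  · rintro ⟨h, h'⟩
    rcases h.lt_or_eq with h1 | h1
    · exact Or.inl h1
    · refine Or.inr ⟨h1, ?_⟩
      rcases lt_or_gt_of_ne hab' with h2 | h2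
      · exact h2
      · exact absurd (h' h2) h1.not_lt

lemma aux_iff {c : Finset ℕ+} (f : {x // x ∈ c} → ℕ+) (π : List ℕ+) (hn : π.Nodup)
    (hm : ∀ x, x ∈ π ↔ x ∈ c) :
    IsPPartition (chainRel π) f ↔ π.Pairwise (fun a b => auxKey f a < auxKey f b) := by
  rw [List.pairwise_iff_get]
  constructor
  · intro h i j hij
    have hne : π.get i ≠ π.get j := fun h => hij.ne (hn.injective_get h)
    exact (auxKey_lt f ⟨π.get i, (hm _).1 (List.get_mem _ _)⟩
      ⟨π.get j, (hm _).1 (List.get_mem _ _)⟩ (fun h => hne (congrArg Subtype.val h))).2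
      (h _ _ ⟨i, j, hij, rfl, rfl⟩)
  · rintro h a b ⟨i, j, hij, hi, hj⟩
    have hne : π.get i ≠ π.get j := fun h => hij.ne (hn.injective_get h)
    refine (auxKey_lt f a b ?_).1 ?_
    · rintro rfl
      exact hne (hi.trans hj.symm)
    · rw [← hi, ← hj]
      exact h i j hij

lemma aux_exists (P : LabeledPoset) (f : {x // x ∈ P.carrier} → ℕ+)
    (hf : IsPPartition P.lt f) :
    ∃ π, IsLinearExtension (· ∈ P.carrier) P.lt π ∧ IsPPartition (chainRel π) f := by
  obtain ⟨π, hp, hs⟩ : ∃ π : List ℕ+, (∀ x, x ∈ π ↔ x ∈ P.carrier) ∧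
      π.Pairwise (fun a b => auxKey f a < auxKey f b) := by
    refine ⟨((P.carrier.image (auxKey f)).sort (· ≤ ·)).map (fun p => (ofLex p).2), ?_, ?_⟩
    · intro x
      simp [auxKey]
    · rw [List.pairwise_map]
      refine List.Pairwise.imp_of_mem ?_ (Finset.sortedLT_sort (P.carrier.image (auxKey f))).pairwise
      intro a b ha hb hab
      simp only [Finset.mem_sort, Finset.mem_image] at ha hb
      obtain ⟨x, -, rfl⟩ := ha
      obtain ⟨y, -, rfl⟩ := hb
      exact hab
  have hn : π.Nodup := hs.imp fun {a b} h e => by subst e; exact lt_irrefl _ h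
  refine ⟨π, ⟨hn, hp, ?_⟩, (aux_iff f π hn hp).2 hs⟩
  intro a b hab
  obtain ⟨ha, hb⟩ := P.mem_of_lt hab
  have hne : a ≠ b := by rintro rfl; exact P.lt_irrefl _ hab
  have key : auxKey f a < auxKey f b :=
    (auxKey_lt f ⟨a, ha⟩ ⟨b, hb⟩ (by simpa using hne)).2 (hf ⟨a, ha⟩ ⟨b, hb⟩ hab)
  obtain ⟨i, hi⟩ := List.get_of_mem ((hp a).2 ha)
  obtain ⟨j, hj⟩ := List.get_of_mem ((hp b).2 hb)
  refine ⟨i, j, ?_, hi, hj⟩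
  rcases lt_trichotomy i j with h | h | h
  · exact h
  · subst h
    exact absurd (hi.symm.trans hj) hne
  · have := List.pairwise_iff_get.1 hs j i h
    rw [hi, hj] at this
    exact absurd this key.not_gt

lemma aux_unique {c : Finset ℕ+} {r : ℕ+ → ℕ+ → Prop} (f : {x // x ∈ c} → ℕ+)
    {π ρ : List ℕ+} (hπ : IsLinearExtension (· ∈ c) r π) (hρ : IsLinearExtension (· ∈ c) r ρ)
    (h1 : IsPPartition (chainRel π) f) (h2 : IsPPartition (chainRel ρ) f) : π = ρ := by
  rw [aux_iff f π hπ.1 hπ.2.1] at h1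
  rw [aux_iff f ρ hρ.1 hρ.2.1] at h2
  have hp : π.Perm ρ := (List.perm_ext_iff_of_nodup hπ.1 hρ.1).2 fun a => by
    rw [hπ.2.1, hρ.2.1]
  exact hp.eq_of_pairwise (fun a b _ _ h h' => absurd h h'.not_gt) h1 h2

/-- `Γ(P) = Σ_{π ∈ L(P)} Γ(π)`: the `P`-partition generating function of a
labeled poset is the sum of the generating functions of its linear extensions. -/
theorem statement1 (P : LabeledPoset) :
    genGF (IsPPartition (c := P.carrier) (S := ℕ+) P.lt) (id : ℕ+ → ℕ+) =
      ∑ᶠ π ∈ {π : List ℕ+ | IsLinearExtension (· ∈ P.carrier) P.lt π},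
        genGF (IsPPartition (c := P.carrier) (S := ℕ+) (chainRel π)) (id : ℕ+ → ℕ+) := by
  classical
  rw [finsum_mem_eq_finite_toFinset_sum _ (aux_finite_ext P.carrier P.lt)]
  ext d
  rw [map_sum]
  set S := (aux_finite_ext P.carrier P.lt).toFinset with hS
  have hmem : ∀ π, π ∈ S ↔ IsLinearExtension (· ∈ P.carrier) P.lt π := by
    intro π; simp [hS]
  rw [← Finset.sum_coe_sort S]
  let F : (({x // x ∈ P.carrier} → ℕ+) → Prop) → Type := fun cond =>
    {f : {x // x ∈ P.carrier} → ℕ+ //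
      cond f ∧ ∀ s : ℕ+, Nat.card {i : {x // x ∈ P.carrier} // id (f i) = s} = d s}
  change ((Nat.card (F (IsPPartition P.lt)) : ℕ) : ℚ) =
    ∑ π : S, ((Nat.card (F (IsPPartition (chainRel π.1))) : ℕ) : ℚ)
  have : ∀ cond, Finite (F cond) := fun cond => aux_finite_fun cond d
  rw [← Nat.cast_sum, ← Nat.card_sigma]
  congr 1
  symm
  refine Nat.card_congr (Equiv.ofBijective
    (fun p => (⟨p.2.1, fun a b hab =>
      p.2.2.1 a b (((hmem _).1 p.1.2).2.2 _ _ hab), p.2.2.2⟩ : F (IsPPartition P.lt))) ⟨?_, ?_⟩)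
  · rintro ⟨⟨π, hπ⟩, f, hf, hd⟩ ⟨⟨ρ, hρ⟩, g, hg, hd'⟩ h
    obtain rfl : f = g := congrArg Subtype.val h
    obtain rfl := aux_unique f ((hmem _).1 hπ) ((hmem _).1 hρ) hf hg
    rfl
  · rintro ⟨f, hf, hd⟩
    obtain ⟨π, hπ, h⟩ := aux_exists P f hf
    exact ⟨⟨⟨π, (hmem _).2 hπ⟩, f, h, hd⟩, rfl⟩
end

section
/- Let P be a labeled poset. For any P-partition f : P → ℙ + ℙ′, the set I = {x ∈ P : f(x) lies in the unprimed copy ℙ} is an order ideal of P, and the map f ↦ (f|_I, f|_{P∖I}) gives a bijection A(P; ℙ + ℙ′) ↔ ⨆_{I ∈ 𝑰(P)} A(I; ℙ) × A(P∖I; ℙ′), the disjoint union being over all order ideals I of P. -/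
/-- `I` is an order ideal of the labeled poset `P`. -/
def IsOrderIdeal (P : LabeledPoset) (I : Finset ℕ+) : Prop :=
  I ⊆ P.carrier ∧ ∀ a b, b ∈ I → P.lt a b → a ∈ I

/-- The set of elements of `P` whose value under `f : P → ℙ + ℙ′` lies in the
first (unprimed) copy `ℙ`.  Here `ℙ + ℙ′` is modelled as `ℕ+ ⊕ₗ ℕ+`, the
disjoint union of two copies of the positive integers with every element of
the first copy below every element of the second. -/
noncomputable def idealOf (P : LabeledPoset) (f : {x // x ∈ P.carrier} → ℕ+ ⊕ₗ ℕ+) :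
    Finset ℕ+ := by
  classical
  exact (P.carrier.attach.filter (fun x => (ofLex (f x)).isLeft)).image Subtype.val

theorem mem_idealOf_iff (P : LabeledPoset) (f : {x // x ∈ P.carrier} → ℕ+ ⊕ₗ ℕ+) (x : ℕ+) :
    x ∈ idealOf P f ↔ ∃ h : x ∈ P.carrier, ∃ n : ℕ+, f ⟨x, h⟩ = toLex (Sum.inl n) := by
  classical
  unfold idealOf
  simp only [Finset.mem_image, Finset.mem_filter, Finset.mem_attach, true_and,
    Sum.isLeft_iff]
  constructor
  · rintro ⟨⟨y, hy⟩, ⟨n, hn⟩, rfl⟩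
    exact ⟨hy, n, hn⟩
  · rintro ⟨h, n, hn⟩
    exact ⟨⟨x, h⟩, ⟨n, hn⟩, rfl⟩

theorem exists_inr_of_notMem_idealOf (P : LabeledPoset)
    (f : {x // x ∈ P.carrier} → ℕ+ ⊕ₗ ℕ+) (x : ℕ+) (h : x ∈ P.carrier)
    (hx : x ∉ idealOf P f) : ∃ n : ℕ+, f ⟨x, h⟩ = toLex (Sum.inr n) := by
  rw [mem_idealOf_iff] at hx
  rcases hf : ofLex (f ⟨x, h⟩) with n | n
  · exact absurd ⟨h, n, hf⟩ hx
  · exact ⟨n, hf⟩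

/-- For every `P`-partition `f : P → ℙ + ℙ′`, the set
`I = {x ∈ P : f x ∈ ℙ}` is an order ideal of `P`, and
`f ↦ (f|_I, f|_{P∖I})` gives a bijection
`A(P; ℙ+ℙ′) ↔ ⨆_{I ∈ 𝑰(P)} A(I;ℙ) × A(P∖I;ℙ′)`:
for each order ideal `I`, restriction is a bijection from the `P`-partitions
whose ideal is `I` onto `A(I;ℙ) × A(P∖I;ℙ′)`. -/
theorem statement4 (P : LabeledPoset) :
    (∀ f ∈ {f : {x // x ∈ P.carrier} → ℕ+ ⊕ₗ ℕ+ | IsPPartition P.lt f},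
        IsOrderIdeal P (idealOf P f)) ∧
    ∀ I : Finset ℕ+, ∀ hI : IsOrderIdeal P I,
      Set.BijOn
        (fun f : {x // x ∈ P.carrier} → ℕ+ ⊕ₗ ℕ+ =>
          ((fun x : {x // x ∈ I} => Sum.elim id id (ofLex (f ⟨x.1, hI.1 x.2⟩))),
           (fun x : {x // x ∈ P.carrier \ I} =>
             Sum.elim id id (ofLex (f ⟨x.1, (Finset.mem_sdiff.mp x.2).1⟩)))))
        {f : {x // x ∈ P.carrier} → ℕ+ ⊕ₗ ℕ+ | IsPPartition P.lt f ∧ idealOf P f = I}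
        (Set.prod {g : {x // x ∈ I} → ℕ+ | IsPPartition P.lt g}
          {g : {x // x ∈ P.carrier \ I} → ℕ+ | IsPPartition P.lt g}) := by
  classical
  refine ⟨?_, ?_⟩
  · intro f hf
    refine ⟨fun x hx => ((mem_idealOf_iff P f x).1 hx).1, ?_⟩
    intro a b hb hab
    obtain ⟨hbP, n, hn⟩ := (mem_idealOf_iff P f b).1 hb
    have haP := (P.mem_of_lt hab).1
    by_contra ha
    obtain ⟨m, hm⟩ := exists_inr_of_notMem_idealOf P f a haP ha
    have h := (hf ⟨a, haP⟩ ⟨b, hbP⟩ hab).1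
    rw [hm, hn] at h
    exact Sum.Lex.not_inr_le_inl h
  · intro I hI
    refine ⟨?_, ?_, ?_⟩
    · rintro f ⟨hf, rfl⟩
      refine ⟨?_, ?_⟩
      · intro a b hab
        obtain ⟨ha, n, hn⟩ := (mem_idealOf_iff P f a).1 a.2
        obtain ⟨hb, m, hm⟩ := (mem_idealOf_iff P f b).1 b.2
        have h := hf ⟨a, ha⟩ ⟨b, hb⟩ hab
        rw [hn, hm] at h
        simpa [hn, hm] using h
      · intro a b hab
        obtain ⟨ha, ha'⟩ := Finset.mem_sdiff.mp a.2
        obtain ⟨hb, hb'⟩ := Finset.mem_sdiff.mp b.2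
        obtain ⟨n, hn⟩ := exists_inr_of_notMem_idealOf P f a ha ha'
        obtain ⟨m, hm⟩ := exists_inr_of_notMem_idealOf P f b hb hb'
        have h := hf ⟨a, ha⟩ ⟨b, hb⟩ hab
        rw [hn, hm] at h
        simpa [hn, hm] using h
    · rintro f ⟨hf, hfI⟩ g ⟨hg, hgI⟩ hfg
      obtain ⟨h1, h2⟩ := Prod.mk.inj hfg
      funext ⟨x, hx⟩
      by_cases hxI : x ∈ I
      · obtain ⟨_, n, hn⟩ := (mem_idealOf_iff P f x).1 (hfI ▸ hxI)
        obtain ⟨_, m, hm⟩ := (mem_idealOf_iff P g x).1 (hgI ▸ hxI)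
        have h := congrFun h1 ⟨x, hxI⟩
        simp only [hn, hm, ofLex_toLex, Sum.elim_inl, id] at h
        rw [hn, hm, h]
      · obtain ⟨n, hn⟩ := exists_inr_of_notMem_idealOf P f x hx (hfI ▸ hxI)
        obtain ⟨m, hm⟩ := exists_inr_of_notMem_idealOf P g x hx (hgI ▸ hxI)
        have h := congrFun h2 ⟨x, Finset.mem_sdiff.mpr ⟨hx, hxI⟩⟩
        simp only [hn, hm, ofLex_toLex, Sum.elim_inr, id] at h
        rw [hn, hm, h]
    · rintro ⟨g, k⟩ ⟨hg, hk⟩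
      let f : {x // x ∈ P.carrier} → ℕ+ ⊕ₗ ℕ+ := fun x =>
        if h : x.1 ∈ I then toLex (Sum.inl (g ⟨x.1, h⟩))
        else toLex (Sum.inr (k ⟨x.1, Finset.mem_sdiff.mpr ⟨x.2, h⟩⟩))
      have fl : ∀ x (hx : x ∈ P.carrier) (h : x ∈ I),
          f ⟨x, hx⟩ = toLex (Sum.inl (g ⟨x, h⟩)) := fun x hx h => dif_pos h
      have fr : ∀ x (hx : x ∈ P.carrier) (h : x ∉ I),
          f ⟨x, hx⟩ = toLex (Sum.inr (k ⟨x, Finset.mem_sdiff.mpr ⟨hx, h⟩⟩)) :=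
        fun x hx h => dif_neg h
      refine ⟨f, ⟨?_, ?_⟩, ?_⟩
      · rintro ⟨a, ha⟩ ⟨b, hb⟩ hab
        by_cases hbI : b ∈ I
        · have haI := hI.2 a b hbI hab
          rw [fl a ha haI, fl b hb hbI]
          simpa using hg ⟨a, haI⟩ ⟨b, hbI⟩ hab
        · by_cases haI : a ∈ I
          · rw [fl a ha haI, fr b hb hbI]
            exact ⟨(Sum.Lex.inl_lt_inr _ _).le, fun _ => Sum.Lex.inl_lt_inr _ _⟩
          · rw [fr a ha haI, fr b hb hbI]
            simpa using hk ⟨a, Finset.mem_sdiff.mpr ⟨ha, haI⟩⟩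
              ⟨b, Finset.mem_sdiff.mpr ⟨hb, hbI⟩⟩ hab
      · ext x
        rw [mem_idealOf_iff]
        constructor
        · rintro ⟨h, n, hn⟩
          by_contra hx
          rw [fr x h hx] at hn
          simp at hn
        · intro hx
          exact ⟨hI.1 hx, _, fl x (hI.1 hx) hx⟩
      · refine Prod.ext ?_ ?_
        · funext x
          simp [fl x.1 (hI.1 x.2) x.2]
        · funext x
          have h := Finset.mem_sdiff.mp x.2
          simp [fr x.1 h.1 h.2]
end

section
/- Let P be a labeled poset. Define Γ(P)(X,Y) as the formal power series in commuting variables x₁, x₂, …, y₁, y₂, … over ℚ given by Σ_{f ∈ A(P; ℙ+ℙ′)} ∏_{i ∈ P} z_{f(i)}, where z_k = x_k for unprimed values k and z_{k′} = y_k for primed values k′. Then Γ(P)(X,Y) = Σ_{I ∈ 𝑰(P)} Γ(I)(X)·Γ(P∖I)(Y), summed over all order ideals I of P, where Γ(I)(X) is the usual generating function in the x-variables and Γ(P∖I)(Y) the one in the y-variables. -/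
namespace S5

open Finset

noncomputable def content {ι σ : Type*} [Fintype ι] (w : ι → σ) : σ →₀ ℕ :=
  ∑ i, Finsupp.single (w i) 1

lemma content_apply {ι σ : Type*} [Fintype ι] (w : ι → σ) (s : σ) :
    content w s = Nat.card {i : ι // w i = s} := by
  classical
  simp [content, Finsupp.finsetSum_apply, Finsupp.single_apply, Fintype.card_subtype]

lemma cond_iff {ι σ : Type*} [Fintype ι] (w : ι → σ) (d : σ →₀ ℕ) :
    (∀ s, Nat.card {i : ι // w i = s} = d s) ↔ content w = d := by
  rw [Finsupp.ext_iff]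
  simp only [content_apply]

lemma genGF_coeff {ι A σ : Type*} [Fintype ι] (cond : (ι → A) → Prop) (v : A → σ) (d : σ →₀ ℕ) :
    MvPowerSeries.coeff d (genGF cond v) =
      (Nat.card {x : {f : ι → A // cond f} // content (fun i => v (x.1 i)) = d} : ℚ) := by
  have h : MvPowerSeries.coeff d (genGF cond v) = genGF cond v d := rfl
  rw [h, genGF]
  congr 1
  refine Nat.card_congr (Equiv.trans ?_ (Equiv.subtypeSubtypeEquivSubtypeInter cond
    (fun f => content (fun i => v (f i)) = d)).symm)
  exact Equiv.subtypeEquivRight fun f => and_congr_right fun _ => cond_iff (fun i => v (f i)) d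

lemma finite_content {ι A σ : Type*} [Fintype ι] (cond : (ι → A) → Prop) (v : A → σ)
    (hv : Function.Injective v) (d : σ →₀ ℕ) :
    Finite {x : {f : ι → A // cond f} // content (fun i => v (x.1 i)) = d} := by
  have : ∀ x : {x : {f : ι → A // cond f} // content (fun i => v (x.1 i)) = d}, ∀ i,
      v (x.1.1 i) ∈ d.support := by
    rintro ⟨x, rfl⟩ i
    rw [Finsupp.mem_support_iff, content_apply]
    have : Nonempty {j : ι // v (x.1 j) = v (x.1 i)} := ⟨⟨i, rfl⟩⟩
    exact Nat.card_pos.ne'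
  refine Finite.of_injective
    (β := ι → d.support) (fun x i => ⟨v (x.1.1 i), this x i⟩) ?_
  intro x y hxy
  apply Subtype.ext
  apply Subtype.ext
  funext i
  have := congrFun hxy i
  simp only [Subtype.mk.injEq] at this
  exact hv this

lemma card_prod_content {X Y σ : Type*} (c : X → σ →₀ ℕ) (c' : Y → σ →₀ ℕ) (d : σ →₀ ℕ)
    [DecidableEq σ]
    (hX : ∀ d, Finite {x // c x = d}) (hY : ∀ d, Finite {y // c' y = d}) :
    Finite {z : X × Y // c z.1 + c' z.2 = d} ∧
    Nat.card {z : X × Y // c z.1 + c' z.2 = d} =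
      ∑ p ∈ antidiagonal d, Nat.card {x // c x = p.1} * Nat.card {y // c' y = p.2} := by
  let e : {z : X × Y // c z.1 + c' z.2 = d} ≃
      Σ p : antidiagonal d, {x // c x = p.1.1} × {y // c' y = p.1.2} :=
    { toFun := fun z => ⟨⟨(c z.1.1, c' z.1.2), by simpa using z.2⟩, ⟨z.1.1, rfl⟩, ⟨z.1.2, rfl⟩⟩
      invFun := fun q => ⟨(q.2.1.1, q.2.2.1), by
        rw [q.2.1.2, q.2.2.2]; exact mem_antidiagonal.1 q.1.2⟩
      left_inv := fun z => rfl
      right_inv := by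
        rintro ⟨⟨⟨a, b⟩, h⟩, ⟨x, hx⟩, ⟨y, hy⟩⟩
        simp only at hx hy
        subst hx hy
        rfl }
  refine ⟨Finite.of_equiv _ e.symm, ?_⟩
  rw [Nat.card_congr e, Nat.card_sigma]
  simp only [Nat.card_prod]
  exact Finset.sum_coe_sort (antidiagonal d)
    (fun p => Nat.card {x // c x = p.1} * Nat.card {y // c' y = p.2})

noncomputable def split {C I : Finset ℕ+} (hI : I ⊆ C) :
    {x // x ∈ I} ⊕ {x // x ∈ C \ I} ≃ {x // x ∈ C} :=
  Equiv.ofBijective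
    (Sum.elim (fun a => ⟨a.1, hI a.2⟩) (fun a => ⟨a.1, (mem_sdiff.1 a.2).1⟩)) (by
      constructor
      · rintro (⟨a, ha⟩ | ⟨a, ha⟩) (⟨b, hb⟩ | ⟨b, hb⟩) h <;>
          simp only [Sum.elim_inl, Sum.elim_inr, Subtype.mk.injEq] at h <;> subst h
        · rfl
        · exact absurd ha (mem_sdiff.1 hb).2
        · exact absurd hb (mem_sdiff.1 ha).2
        · rfl
      · rintro ⟨a, ha⟩
        by_cases h : a ∈ I
        · exact ⟨Sum.inl ⟨a, h⟩, rfl⟩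
        · exact ⟨Sum.inr ⟨a, mem_sdiff.2 ⟨ha, h⟩⟩, rfl⟩)

noncomputable def comb {C I : Finset ℕ+} (hI : I ⊆ C) (g : {x // x ∈ I} → ℕ+)
    (h : {x // x ∈ C \ I} → ℕ+) : {x // x ∈ C} → ℕ+ ⊕ₗ ℕ+ :=
  fun a => toLex (Sum.map g h ((split hI).symm a))

lemma comb_split {C I : Finset ℕ+} (hI : I ⊆ C) (g : {x // x ∈ I} → ℕ+)
    (h : {x // x ∈ C \ I} → ℕ+) (s) : comb hI g h (split hI s) = toLex (Sum.map g h s) := by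
  simp [comb]

lemma comb_inl {C I : Finset ℕ+} (hI : I ⊆ C) (g : {x // x ∈ I} → ℕ+)
    (h : {x // x ∈ C \ I} → ℕ+) (a : ℕ+) (ha : a ∈ C) (ha' : a ∈ I) :
    comb hI g h ⟨a, ha⟩ = toLex (Sum.inl (g ⟨a, ha'⟩)) :=
  comb_split hI g h (Sum.inl ⟨a, ha'⟩)

lemma comb_inr {C I : Finset ℕ+} (hI : I ⊆ C) (g : {x // x ∈ I} → ℕ+)
    (h : {x // x ∈ C \ I} → ℕ+) (a : ℕ+) (ha : a ∈ C) (ha' : a ∉ I) :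
    comb hI g h ⟨a, ha⟩ = toLex (Sum.inr (h ⟨a, mem_sdiff.2 ⟨ha, ha'⟩⟩)) :=
  comb_split hI g h (Sum.inr ⟨a, mem_sdiff.2 ⟨ha, ha'⟩⟩)

lemma content_comb {C I : Finset ℕ+} (hI : I ⊆ C) (g : {x // x ∈ I} → ℕ+)
    (h : {x // x ∈ C \ I} → ℕ+) :
    content (fun i => (ofLex (comb hI g h i) : ℕ+ ⊕ ℕ+)) =
      content (fun i => (Sum.inl (g i) : ℕ+ ⊕ ℕ+)) +
      content (fun i => (Sum.inr (h i) : ℕ+ ⊕ ℕ+)) := by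
  unfold content
  rw [← Equiv.sum_comp (split hI), Fintype.sum_sum_type]
  simp only [comb_split]
  rfl

lemma comb_cond (P : LabeledPoset) {I : Finset ℕ+} (hI : IsOrderIdeal P I)
    (g : {x // x ∈ I} → ℕ+) (h : {x // x ∈ P.carrier \ I} → ℕ+)
    (hg : IsPPartition P.lt g) (hh : IsPPartition P.lt h) :
    IsPPartition P.lt (comb hI.1 g h) := by
  rintro ⟨a, ha⟩ ⟨b, hb⟩ hab
  simp only at hab
  by_cases hbI : b ∈ I
  · have haI := hI.2 a b hbI hab
    rw [comb_inl _ _ _ _ _ haI, comb_inl _ _ _ _ _ hbI, Sum.Lex.inl_le_inl_iff,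
      Sum.Lex.inl_lt_inl_iff]
    exact hg ⟨a, haI⟩ ⟨b, hbI⟩ hab
  · by_cases haI : a ∈ I
    · rw [comb_inl _ _ _ _ _ haI, comb_inr _ _ _ _ _ hbI]
      exact ⟨Sum.Lex.inl_le_inr _ _, fun _ => Sum.Lex.inl_lt_inr _ _⟩
    · rw [comb_inr _ _ _ _ _ haI, comb_inr _ _ _ _ _ hbI, Sum.Lex.inr_le_inr_iff,
        Sum.Lex.inr_lt_inr_iff]
      exact hh ⟨a, _⟩ ⟨b, _⟩ hab

abbrev T (P : LabeledPoset) : Type :=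
  Σ I : {I : Finset ℕ+ // IsOrderIdeal P I},
    {g : {x // x ∈ I.1} → ℕ+ // IsPPartition P.lt g} ×
    {h : {x // x ∈ P.carrier \ I.1} → ℕ+ // IsPPartition P.lt h}

noncomputable def F (P : LabeledPoset) (t : T P) :
    {f : {x // x ∈ P.carrier} → ℕ+ ⊕ₗ ℕ+ // IsPPartition P.lt f} :=
  ⟨comb t.1.2.1 t.2.1.1 t.2.2.1, comb_cond P t.1.2 _ _ t.2.1.2 t.2.2.2⟩

lemma mem_iff {C I : Finset ℕ+} (hI : I ⊆ C) (g : {x // x ∈ I} → ℕ+)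
    (h : {x // x ∈ C \ I} → ℕ+) (a : ℕ+) :
    a ∈ I ↔ ∃ ha : a ∈ C, ∃ k, comb hI g h ⟨a, ha⟩ = toLex (Sum.inl k) := by
  constructor
  · intro h'
    exact ⟨hI h', _, comb_inl _ _ _ _ _ h'⟩
  · rintro ⟨ha, k, hk⟩
    by_contra h'
    rw [comb_inr _ _ _ _ _ h'] at hk
    exact Sum.inr_ne_inl (toLex.injective hk)

lemma F_inj (P : LabeledPoset) : Function.Injective (F P) := by
  rintro ⟨⟨I, hI⟩, ⟨g, hg⟩, ⟨h, hh⟩⟩ ⟨⟨I', hI'⟩, ⟨g', hg'⟩, ⟨h', hh'⟩⟩ heq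
  have heq : comb hI.1 g h = comb hI'.1 g' h' := congrArg Subtype.val heq
  have : I = I' := by
    ext a
    rw [mem_iff hI.1 g h, mem_iff hI'.1 g' h', heq]
  subst this
  have h1 : g = g' := by
    funext a
    have := congrFun heq ⟨a.1, hI.1 a.2⟩
    rw [comb_inl _ _ _ _ _ a.2, comb_inl _ _ _ _ _ a.2] at this
    exact Sum.inl_injective (toLex.injective this)
  have h2 : h = h' := by
    funext a
    have ha := mem_sdiff.1 a.2
    have := congrFun heq ⟨a.1, ha.1⟩
    rw [comb_inr _ _ _ _ _ ha.2, comb_inr _ _ _ _ _ ha.2] at this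
    exact Sum.inr_injective (toLex.injective this)
  subst h1 h2
  rfl

lemma F_surj (P : LabeledPoset) : Function.Surjective (F P) := by
  classical
  rintro ⟨f, hf⟩
  let I : Finset ℕ+ := P.carrier.filter
    (fun a => ∃ ha : a ∈ P.carrier, ∃ k, f ⟨a, ha⟩ = toLex (Sum.inl k))
  have hsub : I ⊆ P.carrier := filter_subset _ _
  have hgex : ∀ a : {x // x ∈ I}, ∃ k, f ⟨a.1, hsub a.2⟩ = toLex (Sum.inl k) := by
    rintro ⟨a, ha⟩
    obtain ⟨_, k, hk⟩ := (mem_filter.1 ha).2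
    exact ⟨k, hk⟩
  have hhex : ∀ a : {x // x ∈ P.carrier \ I}, ∃ k,
      f ⟨a.1, (mem_sdiff.1 a.2).1⟩ = toLex (Sum.inr k) := by
    rintro ⟨a, ha⟩
    have hn := (mem_sdiff.1 ha).2
    have hc := (mem_sdiff.1 ha).1
    rcases hfa : ofLex (f ⟨a, hc⟩) with k | k
    · exact absurd (mem_filter.2 ⟨hc, hc, k, hfa⟩) hn
    · exact ⟨k, hfa⟩
  choose g hg using hgex
  choose h hh using hhex
  have hI : IsOrderIdeal P I := by
    refine ⟨hsub, fun a b hb hab => ?_⟩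
    have hm := P.mem_of_lt hab
    by_contra ha
    have h1 := (hf ⟨a, hm.1⟩ ⟨b, hm.2⟩ hab).1
    have h2 := hh ⟨a, mem_sdiff.2 ⟨hm.1, ha⟩⟩
    have h3 := hg ⟨b, hb⟩
    simp only at h2 h3
    rw [h2, h3] at h1
    exact Sum.Lex.not_inr_le_inl h1
  have hgP : IsPPartition P.lt g := by
    intro a b hab
    have := hf ⟨a.1, hsub a.2⟩ ⟨b.1, hsub b.2⟩ hab
    rwa [hg, hg, Sum.Lex.inl_le_inl_iff, Sum.Lex.inl_lt_inl_iff] at this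
  have hhP : IsPPartition P.lt h := by
    intro a b hab
    have := hf ⟨a.1, (mem_sdiff.1 a.2).1⟩ ⟨b.1, (mem_sdiff.1 b.2).1⟩ hab
    rwa [hh, hh, Sum.Lex.inr_le_inr_iff, Sum.Lex.inr_lt_inr_iff] at this
  refine ⟨⟨⟨I, hI⟩, ⟨g, hgP⟩, ⟨h, hhP⟩⟩, Subtype.ext ?_⟩
  change comb hsub g h = f
  funext ⟨a, ha⟩
  by_cases haI : a ∈ I
  · rw [comb_inl _ _ _ _ _ haI]
    exact (hg ⟨a, haI⟩).symm
  · rw [comb_inr _ _ _ _ _ haI]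
    exact (hh ⟨a, _⟩).symm

end S5

/-- `Γ(P)(X+Y) = Σ_{I ∈ 𝑰(P)} Γ(I)(X)·Γ(P∖I)(Y)`.  The variables are indexed by
`ℕ+ ⊕ ℕ+` (`inl k` is `x_k`, `inr k` is `y_k`); `ℙ + ℙ′` is modelled as
`ℕ+ ⊕ₗ ℕ+`, and the sum on the right runs over all order ideals of `P`. -/
theorem statement5 (P : LabeledPoset) :
    genGF (IsPPartition (c := P.carrier) (S := ℕ+ ⊕ₗ ℕ+) P.lt)
        (fun z => (ofLex z : ℕ+ ⊕ ℕ+)) =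
      ∑ᶠ I ∈ {I : Finset ℕ+ | IsOrderIdeal P I},
        genGF (IsPPartition (c := I) (S := ℕ+) P.lt) (fun k => (Sum.inl k : ℕ+ ⊕ ℕ+)) *
        genGF (IsPPartition (c := P.carrier \ I) (S := ℕ+) P.lt)
          (fun k => (Sum.inr k : ℕ+ ⊕ ℕ+)) := by
  classical
  have hfin : {I : Finset ℕ+ | IsOrderIdeal P I}.Finite :=
    (P.carrier.powerset.finite_toSet).subset fun I hI => by
      simpa using hI.1
  letI i1 : Fintype ↑{I : Finset ℕ+ | IsOrderIdeal P I} := hfin.fintype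
  letI i2 : Fintype {I : Finset ℕ+ // IsOrderIdeal P I} := i1
  rw [← finsum_set_coe_eq_finsum_mem, finsum_eq_sum_of_fintype]
  ext d
  rw [map_sum, S5.genGF_coeff]
  let e := Equiv.ofBijective (S5.F P) ⟨S5.F_inj P, S5.F_surj P⟩
  have key : ∀ I : {I : Finset ℕ+ // IsOrderIdeal P I}, _ := fun I =>
    S5.card_prod_content
      (fun x : {g : {x // x ∈ I.1} → ℕ+ // IsPPartition P.lt g} =>
        S5.content (fun i => (Sum.inl (x.1 i) : ℕ+ ⊕ ℕ+)))
      (fun x : {h : {x // x ∈ P.carrier \ I.1} → ℕ+ // IsPPartition P.lt h} =>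
        S5.content (fun i => (Sum.inr (x.1 i) : ℕ+ ⊕ ℕ+))) d
      (S5.finite_content _ _ Sum.inl_injective) (S5.finite_content _ _ Sum.inr_injective)
  have hcard := Nat.card_congr (e.subtypeEquiv
    (p := fun t : S5.T P => S5.content (fun i => (Sum.inl (t.2.1.1 i) : ℕ+ ⊕ ℕ+)) +
      S5.content (fun i => (Sum.inr (t.2.2.1 i) : ℕ+ ⊕ ℕ+)) = d)
    (q := fun x => S5.content (fun i => (ofLex (x.1 i) : ℕ+ ⊕ ℕ+)) = d)
    (fun t => by
      rw [← S5.content_comb t.1.2.1]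
      rfl))
  rw [← hcard]
  let e2 : {t : S5.T P // S5.content (fun i => (Sum.inl (t.2.1.1 i) : ℕ+ ⊕ ℕ+)) +
      S5.content (fun i => (Sum.inr (t.2.2.1 i) : ℕ+ ⊕ ℕ+)) = d} ≃
      Σ I : {I : Finset ℕ+ // IsOrderIdeal P I},
        {z : {g : {x // x ∈ I.1} → ℕ+ // IsPPartition P.lt g} ×
            {h : {x // x ∈ P.carrier \ I.1} → ℕ+ // IsPPartition P.lt h} //
          S5.content (fun i => (Sum.inl (z.1.1 i) : ℕ+ ⊕ ℕ+)) +
          S5.content (fun i => (Sum.inr (z.2.1 i) : ℕ+ ⊕ ℕ+)) = d} :=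
    { toFun := fun t => ⟨t.1.1, t.1.2, t.2⟩
      invFun := fun q => ⟨⟨q.1, q.2.1⟩, q.2.2⟩
      left_inv := fun _ => rfl
      right_inv := fun _ => rfl }
  have := fun I => (key I).1
  rw [Nat.card_congr e2, Nat.card_sigma, Nat.cast_sum]
  refine Finset.sum_congr rfl fun I _ => ?_
  rw [(key I).2, MvPowerSeries.coeff_mul, Nat.cast_sum]
  refine Finset.sum_congr rfl fun p _ => ?_
  rw [S5.genGF_coeff, S5.genGF_coeff, Nat.cast_mul]
end

section
/- Let P be a labeled poset and let ℙ^± + (ℙ^±)′ be the totally ordered set −1 < 1 < −2 < 2 < ⋯ < −1′ < 1′ < −2′ < 2′ < ⋯ (two copies of ℙ^±, every element of the first copy below every element of the second). For any enriched P-partition f : P → ℙ^± + (ℙ^±)′, the set I = {x ∈ P : f(x) lies in the first copy ℙ^±} is an order ideal of P, and the map f ↦ (f|_I, f|_{P∖I}) gives a bijection E(P; ℙ^± + (ℙ^±)′) ↔ ⨆_{I ∈ 𝑰(P)} E(I; ℙ^±) × E(P∖I; (ℙ^±)′), the disjoint union being over all order ideals I of P. -/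
/-- `f` is an enriched `P`-partition for the strict order `r` on the carrier
`c`, with values in a totally ordered set `A` in which every element carries a
sign `sgn` (`false` is `−`, `true` is `+`): `f i ≤⁺ f j` whenever `i <_P j`
and `i < j` as integers, and `f i ≤⁻ f j` whenever `i <_P j` and `i > j`. -/
def IsEnrichedPPartitionIn {A : Type*} [LinearOrder A] (sgn : A → Bool) {c : Finset ℕ+}
    (r : ℕ+ → ℕ+ → Prop) (f : {x // x ∈ c} → A) : Prop :=
  ∀ a b : {x // x ∈ c}, r a.1 b.1 →
    ((a : ℕ+) < (b : ℕ+) → f a < f b ∨ (f a = f b ∧ sgn (f a) = true)) ∧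
    ((b : ℕ+) < (a : ℕ+) → f a < f b ∨ (f a = f b ∧ sgn (f a) = false))

/-- The sign of an element of `ℙ^± = Lex (ℕ+ × Bool)`
(ordered `−1 < 1 < −2 < 2 < ⋯`). -/
def sgnPM : Lex (ℕ+ × Bool) → Bool := fun w => (ofLex w).2

/-- The sign of an element of `ℙ^± + (ℙ^±)′ = Lex (ℙ^± ⊕ ℙ^±)`, two copies of
`ℙ^±` with every element of the first copy below every element of the second. -/
def sgnT : Lex (Lex (ℕ+ × Bool) ⊕ Lex (ℕ+ × Bool)) → Bool :=
  fun z => Sum.elim (fun w => (ofLex w).2) (fun w => (ofLex w).2) (ofLex z)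

/-- The set of elements of `P` whose value under
`f : P → ℙ^± + (ℙ^±)′` lies in the first copy `ℙ^±`. -/
noncomputable def idealOfE (P : LabeledPoset)
    (f : {x // x ∈ P.carrier} → Lex (Lex (ℕ+ × Bool) ⊕ Lex (ℕ+ × Bool))) : Finset ℕ+ := by
  classical
  exact (P.carrier.attach.filter (fun x => (ofLex (f x)).isLeft)).image Subtype.val

theorem mem_idealOfE_iff (P : LabeledPoset)
    (f : {x // x ∈ P.carrier} → Lex (Lex (ℕ+ × Bool) ⊕ Lex (ℕ+ × Bool))) (x : ℕ+) :
    x ∈ idealOfE P f ↔ ∃ h : x ∈ P.carrier, ∃ w, f ⟨x, h⟩ = toLex (Sum.inl w) := by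
  classical
  unfold idealOfE
  simp only [Finset.mem_image, Finset.mem_filter, Finset.mem_attach, true_and]
  constructor
  · rintro ⟨⟨y, hy⟩, h, rfl⟩
    refine ⟨hy, ?_⟩
    obtain ⟨w, hw⟩ := Sum.isLeft_iff.mp h
    exact ⟨w, hw⟩
  · rintro ⟨h, w, hw⟩
    exact ⟨⟨x, h⟩, by rw [hw]; rfl, rfl⟩

theorem notMem_idealOfE (P : LabeledPoset)
    (f : {x // x ∈ P.carrier} → Lex (Lex (ℕ+ × Bool) ⊕ Lex (ℕ+ × Bool))) (x : ℕ+)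
    (h : x ∈ P.carrier) (hx : x ∉ idealOfE P f) : ∃ w, f ⟨x, h⟩ = toLex (Sum.inr w) := by
  rw [mem_idealOfE_iff] at hx
  rcases hf : ofLex (f ⟨x, h⟩) with w | w
  · exact absurd ⟨h, w, hf⟩ hx
  · exact ⟨w, hf⟩

theorem inl_cond (s : Bool) (u v : Lex (ℕ+ × Bool)) :
    ((toLex (Sum.inl u) : Lex (Lex (ℕ+ × Bool) ⊕ Lex (ℕ+ × Bool))) < toLex (Sum.inl v) ∨
      ((toLex (Sum.inl u) : Lex (Lex (ℕ+ × Bool) ⊕ Lex (ℕ+ × Bool))) = toLex (Sum.inl v) ∧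
        sgnT (toLex (Sum.inl u)) = s)) ↔ (u < v ∨ (u = v ∧ sgnPM u = s)) := by
  rw [Sum.Lex.inl_lt_inl_iff, toLex_inj, Sum.inl.injEq]
  rfl

theorem inr_cond (s : Bool) (u v : Lex (ℕ+ × Bool)) :
    ((toLex (Sum.inr u) : Lex (Lex (ℕ+ × Bool) ⊕ Lex (ℕ+ × Bool))) < toLex (Sum.inr v) ∨
      ((toLex (Sum.inr u) : Lex (Lex (ℕ+ × Bool) ⊕ Lex (ℕ+ × Bool))) = toLex (Sum.inr v) ∧
        sgnT (toLex (Sum.inr u)) = s)) ↔ (u < v ∨ (u = v ∧ sgnPM u = s)) := by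
  rw [Sum.Lex.inr_lt_inr_iff, toLex_inj, Sum.inr.injEq]
  rfl

/-- For every enriched `P`-partition `f : P → ℙ^± + (ℙ^±)′`, the set
`I = {x ∈ P : f x ∈ ℙ^±}` is an order ideal of `P`, and `f ↦ (f|_I, f|_{P∖I})`
gives a bijection `E(P; ℙ^±+(ℙ^±)′) ↔ ⨆_{I ∈ 𝑰(P)} E(I;ℙ^±) × E(P∖I;(ℙ^±)′)`:
for each order ideal `I`, restriction is a bijection from the enriched
`P`-partitions whose ideal is `I` onto `E(I;ℙ^±) × E(P∖I;(ℙ^±)′)`. -/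
theorem statement11 (P : LabeledPoset) :
    (∀ f ∈ {f : {x // x ∈ P.carrier} → Lex (Lex (ℕ+ × Bool) ⊕ Lex (ℕ+ × Bool)) |
        IsEnrichedPPartitionIn sgnT P.lt f},
      IsOrderIdeal P (idealOfE P f)) ∧
    ∀ I : Finset ℕ+, ∀ hI : IsOrderIdeal P I,
      Set.BijOn
        (fun f : {x // x ∈ P.carrier} → Lex (Lex (ℕ+ × Bool) ⊕ Lex (ℕ+ × Bool)) =>
          ((fun x : {x // x ∈ I} => Sum.elim id id (ofLex (f ⟨x.1, hI.1 x.2⟩))),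
           (fun x : {x // x ∈ P.carrier \ I} =>
             Sum.elim id id (ofLex (f ⟨x.1, (Finset.mem_sdiff.mp x.2).1⟩)))))
        {f : {x // x ∈ P.carrier} → Lex (Lex (ℕ+ × Bool) ⊕ Lex (ℕ+ × Bool)) |
          IsEnrichedPPartitionIn sgnT P.lt f ∧ idealOfE P f = I}
        (Set.prod
          {g : {x // x ∈ I} → Lex (ℕ+ × Bool) | IsEnrichedPPartitionIn sgnPM P.lt g}
          {g : {x // x ∈ P.carrier \ I} → Lex (ℕ+ × Bool) |
            IsEnrichedPPartitionIn sgnPM P.lt g}) := by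
  classical
  refine ⟨?_, ?_⟩
  · intro f hf
    refine ⟨fun x hx => ((mem_idealOfE_iff P f x).mp hx).1, ?_⟩
    intro a b hb hab
    by_contra ha
    obtain ⟨hbP, w, hw⟩ := (mem_idealOfE_iff P f b).mp hb
    have haP := (P.mem_of_lt hab).1
    obtain ⟨v, hv⟩ := notMem_idealOfE P f a haP ha
    have hne : a ≠ b := by
      rintro rfl
      exact P.lt_irrefl _ hab
    have h := hf ⟨a, haP⟩ ⟨b, hbP⟩ hab
    simp only [hw, hv] at h
    rcases lt_or_gt_of_ne hne with hlt | hlt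
    · rcases h.1 hlt with h | ⟨h, -⟩
      · exact Sum.Lex.not_inr_lt_inl h
      · cases h
    · rcases h.2 hlt with h | ⟨h, -⟩
      · exact Sum.Lex.not_inr_lt_inl h
      · cases h
  · intro I hI
    refine ⟨?_, ?_, ?_⟩
    · rintro f ⟨hf, rfl⟩
      refine ⟨?_, ?_⟩
      · rintro ⟨a, ha⟩ ⟨b, hb⟩ hab
        obtain ⟨haP, u, hu⟩ := (mem_idealOfE_iff P f a).mp ha
        obtain ⟨hbP, v, hv⟩ := (mem_idealOfE_iff P f b).mp hb
        have h := hf ⟨a, haP⟩ ⟨b, hbP⟩ hab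
        simp only [hu, hv, inl_cond] at h
        simpa only [hu, hv, ofLex_toLex, Sum.elim_inl, Sum.elim_inr, id] using h
      · rintro ⟨a, ha⟩ ⟨b, hb⟩ hab
        obtain ⟨haP, ha'⟩ := Finset.mem_sdiff.mp ha
        obtain ⟨hbP, hb'⟩ := Finset.mem_sdiff.mp hb
        obtain ⟨u, hu⟩ := notMem_idealOfE P f a haP ha'
        obtain ⟨v, hv⟩ := notMem_idealOfE P f b hbP hb'
        have h := hf ⟨a, haP⟩ ⟨b, hbP⟩ hab
        simp only [hu, hv, inr_cond] at h
        simpa only [hu, hv, ofLex_toLex, Sum.elim_inl, Sum.elim_inr, id] using h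
    · rintro f ⟨-, hfI⟩ g ⟨-, hgI⟩ hfg
      have h1 := congrFun (Prod.ext_iff.mp hfg).1
      have h2 := congrFun (Prod.ext_iff.mp hfg).2
      funext ⟨x, hx⟩
      by_cases hxI : x ∈ I
      · obtain ⟨_, u, hu⟩ := (mem_idealOfE_iff P f x).mp (hfI ▸ hxI)
        obtain ⟨_, v, hv⟩ := (mem_idealOfE_iff P g x).mp (hgI ▸ hxI)
        have h := h1 ⟨x, hxI⟩
        simp only [hu, hv] at h
        rw [hu, hv]
        exact congrArg (fun w => toLex (Sum.inl w)) h
      · obtain ⟨u, hu⟩ := notMem_idealOfE P f x hx (hfI ▸ hxI)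
        obtain ⟨v, hv⟩ := notMem_idealOfE P g x hx (hgI ▸ hxI)
        have h := h2 ⟨x, Finset.mem_sdiff.mpr ⟨hx, hxI⟩⟩
        simp only [hu, hv] at h
        rw [hu, hv]
        exact congrArg (fun w => toLex (Sum.inr w)) h
    · rintro ⟨g, k⟩ ⟨hg, hk⟩
      let f : {x // x ∈ P.carrier} → Lex (Lex (ℕ+ × Bool) ⊕ Lex (ℕ+ × Bool)) := fun x =>
        if h : x.1 ∈ I then toLex (Sum.inl (g ⟨x.1, h⟩))
        else toLex (Sum.inr (k ⟨x.1, Finset.mem_sdiff.mpr ⟨x.2, h⟩⟩))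
      have f1 : ∀ x (hx : x ∈ P.carrier) (h : x ∈ I),
          f ⟨x, hx⟩ = toLex (Sum.inl (g ⟨x, h⟩)) := fun x hx h => dif_pos h
      have f2 : ∀ x (hx : x ∈ P.carrier) (h : x ∉ I),
          f ⟨x, hx⟩ = toLex (Sum.inr (k ⟨x, Finset.mem_sdiff.mpr ⟨hx, h⟩⟩)) :=
        fun x hx h => dif_neg h
      refine ⟨f, ⟨?_, ?_⟩, ?_⟩
      · rintro ⟨a, ha⟩ ⟨b, hb⟩ hab
        by_cases hbI : b ∈ I
        · have haI := hI.2 a b hbI hab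
          rw [f1 a ha haI, f1 b hb hbI, inl_cond, inl_cond]
          exact hg ⟨a, haI⟩ ⟨b, hbI⟩ hab
        · by_cases haI : a ∈ I
          · rw [f1 a ha haI, f2 b hb hbI]
            exact ⟨fun _ => Or.inl (Sum.Lex.inl_lt_inr _ _),
              fun _ => Or.inl (Sum.Lex.inl_lt_inr _ _)⟩
          · rw [f2 a ha haI, f2 b hb hbI, inr_cond, inr_cond]
            exact hk ⟨a, Finset.mem_sdiff.mpr ⟨ha, haI⟩⟩ ⟨b, Finset.mem_sdiff.mpr ⟨hb, hbI⟩⟩ hab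
      · ext x
        rw [mem_idealOfE_iff]
        constructor
        · rintro ⟨hx, w, hw⟩
          by_contra h
          rw [f2 x hx h] at hw
          cases hw
        · intro h
          exact ⟨hI.1 h, _, f1 x _ h⟩
      · refine Prod.ext ?_ ?_
        · funext ⟨x, hx⟩
          simp only [f1 x (hI.1 hx) hx]
          rfl
        · funext ⟨x, hx⟩
          obtain ⟨hxP, hxI⟩ := Finset.mem_sdiff.mp hx
          simp only [f2 x hxP hxI]
          rfl
end

section
/- Let P be a labeled poset. Define Λ(P)(X,Y) as the formal power series in commuting variables x₁, x₂, …, y₁, y₂, … over ℚ given by Σ_{f ∈ E(P; ℙ^±+(ℙ^±)′)} ∏_{i ∈ P} z_{|f(i)|}, where z_k = x_k for values in the first copy and z_{k′} = y_k for values in the second copy (|·| forgets the sign). Then Λ(P)(X,Y) = Σ_{I ∈ 𝑰(P)} Λ(I)(X)·Λ(P∖I)(Y), summed over all order ideals I of P. -/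
open Classical in
noncomputable def contentOf {ι A σ : Type*} [Fintype ι] (v : A → σ) (f : ι → A) : σ →₀ ℕ :=
  ∑ i, Finsupp.single (v (f i)) 1

lemma contentOf_iff {ι A σ : Type*} [Fintype ι] (v : A → σ) (f : ι → A) (d : σ →₀ ℕ) :
    (∀ s : σ, Nat.card {i : ι // v (f i) = s} = d s) ↔ contentOf v f = d := by
  classical
  rw [Finsupp.ext_iff]
  refine forall_congr' fun s => ?_
  have : contentOf v f s = Nat.card {i : ι // v (f i) = s} := by
    simp [contentOf, Finsupp.finsetSum_apply, Finsupp.single_apply, Fintype.card_subtype]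
  rw [this]

lemma coeff_genGF {ι A σ : Type*} [Fintype ι] (cond : (ι → A) → Prop) (v : A → σ)
    (d : σ →₀ ℕ) :
    MvPowerSeries.coeff d (genGF cond v) =
      (Nat.card {f : ι → A // cond f ∧ contentOf v f = d} : ℚ) := by
  have h : MvPowerSeries.coeff d (genGF cond v) = genGF cond v d := rfl
  rw [h]
  unfold genGF
  simp only [contentOf_iff]

lemma finite_content {ι A σ : Type*} [Fintype ι] (cond : (ι → A) → Prop) (v : A → σ)
    (hv : ∀ s, (v ⁻¹' {s}).Finite) (d : σ →₀ ℕ) :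
    Finite {f : ι → A // cond f ∧ contentOf v f = d} := by
  classical
  have hfin : (v ⁻¹' (d.support : Set σ)).Finite := by
    apply Set.Finite.preimage' d.support.finite_toSet
    intro s _
    exact hv s
  have h2 := Set.Finite.pi' (fun _ : ι => hfin)
  refine (h2.subset (t := {f : ι → A | cond f ∧ contentOf v f = d}) ?_).to_subtype
  rintro f ⟨_, hf⟩ i
  simp only [Set.mem_preimage, Finset.mem_coe, Finsupp.mem_support_iff]
  rw [← hf, contentOf, Finsupp.finsetSum_apply]
  intro h0
  rw [Finset.sum_eq_zero_iff] at h0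
  have := h0 i (Finset.mem_univ i)
  simp at this

lemma coeff_mul_genGF {ι κ A B σ : Type*} [Fintype ι] [Fintype κ]
    (c₁ : (ι → A) → Prop) (v₁ : A → σ) (c₂ : (κ → B) → Prop) (v₂ : B → σ)
    (h₁ : ∀ s, (v₁ ⁻¹' {s}).Finite) (h₂ : ∀ s, (v₂ ⁻¹' {s}).Finite) (d : σ →₀ ℕ) :
    Finite {p : (ι → A) × (κ → B) //
        (c₁ p.1 ∧ c₂ p.2) ∧ contentOf v₁ p.1 + contentOf v₂ p.2 = d} ∧
    MvPowerSeries.coeff d (genGF c₁ v₁ * genGF c₂ v₂) =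
      (Nat.card {p : (ι → A) × (κ → B) //
        (c₁ p.1 ∧ c₂ p.2) ∧ contentOf v₁ p.1 + contentOf v₂ p.2 = d} : ℚ) := by
  classical
  have F₁ := finite_content c₁ v₁ h₁
  have F₂ := finite_content c₂ v₂ h₂
  let e : {p : (ι → A) × (κ → B) //
        (c₁ p.1 ∧ c₂ p.2) ∧ contentOf v₁ p.1 + contentOf v₂ p.2 = d} ≃
      Σ q : {q // q ∈ Finset.HasAntidiagonal.antidiagonal d},
        {f : ι → A // c₁ f ∧ contentOf v₁ f = q.1.1} ×
        {f : κ → B // c₂ f ∧ contentOf v₂ f = q.1.2} :=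
    { toFun := fun p => ⟨⟨(contentOf v₁ p.1.1, contentOf v₂ p.1.2),
          Finset.HasAntidiagonal.mem_antidiagonal.2 p.2.2⟩, ⟨p.1.1, p.2.1.1, rfl⟩, ⟨p.1.2, p.2.1.2, rfl⟩⟩
      invFun := fun x => ⟨(x.2.1.1, x.2.2.1), ⟨x.2.1.2.1, x.2.2.2.1⟩, by
          have := Finset.HasAntidiagonal.mem_antidiagonal.1 x.1.2
          rw [x.2.1.2.2, x.2.2.2.2]; exact this⟩
      left_inv := fun p => rfl
      right_inv := by
        rintro ⟨⟨⟨q₁, q₂⟩, hq⟩, ⟨f, hf, hf'⟩, ⟨g, hg, hg'⟩⟩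
        dsimp only at hf' hg'
        subst hf' hg'
        rfl }
  refine ⟨Finite.of_equiv _ e.symm, ?_⟩
  rw [Nat.card_congr e, Nat.card_sigma, MvPowerSeries.coeff_mul]
  rw [← Finset.sum_coe_sort]
  push_cast
  refine Finset.sum_congr rfl fun q _ => ?_
  rw [coeff_genGF, coeff_genGF, Nat.card_prod]
  push_cast
  rfl

noncomputable def splitEquiv (c I : Finset ℕ+) (h : I ⊆ c) :
    {x // x ∈ I} ⊕ {x // x ∈ c \ I} ≃ {x // x ∈ c} :=
  Equiv.ofBijective
    (Sum.elim (fun x => ⟨x.1, h x.2⟩) (fun x => ⟨x.1, (Finset.mem_sdiff.1 x.2).1⟩)) (by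
    constructor
    · rintro (⟨x, hx⟩ | ⟨x, hx⟩) (⟨y, hy⟩ | ⟨y, hy⟩) hxy <;> simp at hxy <;> subst hxy
      · rfl
      · exact absurd hx (Finset.mem_sdiff.1 hy).2
      · exact absurd hy (Finset.mem_sdiff.1 hx).2
      · rfl
    · rintro ⟨x, hx⟩
      by_cases hI : x ∈ I
      · exact ⟨Sum.inl ⟨x, hI⟩, rfl⟩
      · exact ⟨Sum.inr ⟨x, Finset.mem_sdiff.2 ⟨hx, hI⟩⟩, rfl⟩)

lemma splitEquiv_inl (c I : Finset ℕ+) (h : I ⊆ c) (x : {x // x ∈ I}) :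
    ((splitEquiv c I h (Sum.inl x)) : ℕ+) = x := rfl

lemma splitEquiv_inr (c I : Finset ℕ+) (h : I ⊆ c) (x : {x // x ∈ c \ I}) :
    ((splitEquiv c I h (Sum.inr x)) : ℕ+) = x := rfl

abbrev PM := Lex (ℕ+ × Bool)

noncomputable def glue (c I : Finset ℕ+) (h : I ⊆ c)
    (p : ({x // x ∈ I} → PM) × ({x // x ∈ c \ I} → PM)) : {x // x ∈ c} → Lex (PM ⊕ PM) :=
  fun a => toLex (Sum.map p.1 p.2 ((splitEquiv c I h).symm a))

lemma glue_inl (c I : Finset ℕ+) (h : I ⊆ c) (p) (x : {x // x ∈ I}) :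
    glue c I h p (splitEquiv c I h (Sum.inl x)) = toLex (Sum.inl (p.1 x)) := by
  simp [glue]

lemma glue_inr (c I : Finset ℕ+) (h : I ⊆ c) (p) (x : {x // x ∈ c \ I}) :
    glue c I h p (splitEquiv c I h (Sum.inr x)) = toLex (Sum.inr (p.2 x)) := by
  simp [glue]

lemma glue_content (c I : Finset ℕ+) (h : I ⊆ c) (p) :
    contentOf (fun z : Lex (PM ⊕ PM) =>
      (Sum.map (fun w => (ofLex w).1) (fun w => (ofLex w).1) (ofLex z) : ℕ+ ⊕ ℕ+))
      (glue c I h p) =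
    contentOf (fun w : PM => (Sum.inl (ofLex w).1 : ℕ+ ⊕ ℕ+)) p.1 +
    contentOf (fun w : PM => (Sum.inr (ofLex w).1 : ℕ+ ⊕ ℕ+)) p.2 := by
  unfold contentOf
  rw [← (splitEquiv c I h).sum_comp, Fintype.sum_sum_type]
  simp only [glue_inl, glue_inr, ofLex_toLex, Sum.map_inl, Sum.map_inr]

lemma glue_cond (P : LabeledPoset) (I : Finset ℕ+) (hI : IsOrderIdeal P I) (p) :
    IsEnrichedPPartitionIn (c := P.carrier) sgnT P.lt (glue P.carrier I hI.1 p) ↔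
    IsEnrichedPPartitionIn (c := I) sgnPM P.lt p.1 ∧
    IsEnrichedPPartitionIn (c := P.carrier \ I) sgnPM P.lt p.2 := by
  unfold IsEnrichedPPartitionIn
  rw [← (splitEquiv P.carrier I hI.1).forall_congr_right]
  simp only [← (splitEquiv P.carrier I hI.1).forall_congr_right, Sum.forall, glue_inl, glue_inr,
    splitEquiv_inl, splitEquiv_inr, Sum.Lex.inl_lt_inl_iff, Sum.Lex.inr_lt_inr_iff,
    Sum.Lex.inl_lt_inr, toLex_inj, Sum.inl.injEq, Sum.inr.injEq]
  constructor
  · rintro ⟨h1, h2⟩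
    exact ⟨fun a b => (h1 a).1 b, fun a b => (h2 a).2 b⟩
  · rintro ⟨h1, h2⟩
    refine ⟨fun a => ⟨h1 a, fun b _ => ⟨fun _ => Or.inl trivial, fun _ => Or.inl trivial⟩⟩,
      fun a => ⟨fun b hab => ?_, h2 a⟩⟩
    exact absurd (hI.2 _ _ b.2 hab) (Finset.mem_sdiff.1 a.2).2

open Classical in
noncomputable def leftSet {c : Finset ℕ+} (f : {x // x ∈ c} → Lex (PM ⊕ PM)) : Finset ℕ+ :=
  c.filter (fun a => ∃ h : a ∈ c, (ofLex (f ⟨a, h⟩)).isLeft = true)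

lemma mem_leftSet {c : Finset ℕ+} (f : {x // x ∈ c} → Lex (PM ⊕ PM)) (a : ℕ+) :
    a ∈ leftSet f ↔ ∃ h : a ∈ c, (ofLex (f ⟨a, h⟩)).isLeft = true := by
  classical
  rw [leftSet, Finset.mem_filter]
  exact ⟨fun h => h.2, fun h => ⟨h.1, h⟩⟩

lemma leftSet_ideal (P : LabeledPoset) (f : {x // x ∈ P.carrier} → Lex (PM ⊕ PM))
    (hf : IsEnrichedPPartitionIn (c := P.carrier) sgnT P.lt f) :
    IsOrderIdeal P (leftSet f) := by
  refine ⟨fun a ha => ((mem_leftSet f a).1 ha).1, fun a b hb hab => ?_⟩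
  obtain ⟨hbc, hb⟩ := (mem_leftSet f b).1 hb
  have hac := (P.mem_of_lt hab).1
  refine (mem_leftSet f a).2 ⟨hac, ?_⟩
  have hne : a ≠ b := by
    rintro rfl
    exact P.lt_irrefl _ hab
  have H := hf ⟨a, hac⟩ ⟨b, hbc⟩ hab
  have hle : f ⟨a, hac⟩ ≤ f ⟨b, hbc⟩ := by
    rcases lt_or_gt_of_ne hne with h | h
    · rcases H.1 h with h | h
      exacts [h.le, h.1.le]
    · rcases H.2 h with h | h
      exacts [h.le, h.1.le]
  generalize f ⟨a, hac⟩ = x at *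
  generalize f ⟨b, hbc⟩ = y at *
  induction x using Lex.rec with | _ x
  induction y using Lex.rec with | _ y
  rcases x with x | x
  · rfl
  · rcases y with y | y
    · exact absurd hle Sum.Lex.not_inr_le_inl
    · simp at hb

lemma leftSet_glue (c I : Finset ℕ+) (h : I ⊆ c) (p) : leftSet (glue c I h p) = I := by
  ext a
  rw [mem_leftSet]
  constructor
  · rintro ⟨hc, ha⟩
    obtain ⟨x, hx⟩ := (splitEquiv c I h).surjective ⟨a, hc⟩
    rw [← hx] at ha
    rcases x with x | x
    · have : (x : ℕ+) = a := congrArg Subtype.val hx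
      exact this ▸ x.2
    · rw [glue_inr] at ha
      simp at ha
  · intro ha
    refine ⟨h ha, ?_⟩
    have := glue_inl c I h p ⟨a, ha⟩
    have h2 : splitEquiv c I h (Sum.inl ⟨a, ha⟩) = ⟨a, h ha⟩ := rfl
    rw [h2] at this
    rw [this]
    rfl

lemma glue_injective (c I : Finset ℕ+) (h : I ⊆ c) : Function.Injective (glue c I h) := by
  intro p q hpq
  refine Prod.ext (funext fun x => ?_) (funext fun x => ?_)
  · have := congrFun hpq (splitEquiv c I h (Sum.inl x))
    simpa [glue_inl] using this
  · have := congrFun hpq (splitEquiv c I h (Sum.inr x))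
    simpa [glue_inr] using this

lemma exists_glue (c : Finset ℕ+) (f : {x // x ∈ c} → Lex (PM ⊕ PM)) (h : leftSet f ⊆ c) :
    ∃ p, glue c (leftSet f) h p = f := by
  have h1 : ∀ x : {x // x ∈ leftSet f}, ∃ y : PM,
      f (splitEquiv c _ h (Sum.inl x)) = toLex (Sum.inl y) := by
    intro x
    obtain ⟨hc, hx⟩ := (mem_leftSet f x).1 x.2
    obtain ⟨y, hy⟩ := Sum.isLeft_iff.1 hx
    exact ⟨y, hy⟩
  have h2 : ∀ x : {x // x ∈ c \ leftSet f}, ∃ y : PM,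
      f (splitEquiv c _ h (Sum.inr x)) = toLex (Sum.inr y) := by
    intro x
    obtain ⟨hc, hx⟩ := Finset.mem_sdiff.1 x.2
    have hx' : ¬ (ofLex (f ⟨x, hc⟩)).isLeft = true := fun h' => hx ((mem_leftSet f x).2 ⟨hc, h'⟩)
    obtain ⟨y, hy⟩ := Sum.isRight_iff.1 (Sum.not_isLeft.1 hx')
    exact ⟨y, hy⟩
  choose g hg using h1
  choose k hk using h2
  refine ⟨(g, k), funext fun a => ?_⟩
  obtain ⟨x, rfl⟩ := (splitEquiv c _ h).surjective a
  rcases x with x | x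
  · rw [glue_inl, hg]
  · rw [glue_inr, hk]

lemma finite_fiber {σ : Type*} (j : ℕ+ → σ) (hj : Function.Injective j) (s : σ) :
    ((fun w : PM => j (ofLex w).1) ⁻¹' {s}).Finite := by
  have h : (j ⁻¹' {s}).Finite := (Set.finite_singleton s).preimage hj.injOn
  have h3 := (h.prod (Set.finite_univ (α := Bool))).preimage
    (f := (ofLex : PM → ℕ+ × Bool)) ofLex.injective.injOn
  refine h3.subset ?_
  intro w hw
  simpa using hw

/-- `Λ(P)(X,Y) = Σ_{I ∈ 𝑰(P)} Λ(I)(X)·Λ(P∖I)(Y)`.  The variables are indexed by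
`ℕ+ ⊕ ℕ+` (`inl k` is `x_k`, `inr k` is `y_k`): a value in the first copy of
`ℙ^±` with absolute value `k` contributes `x_k`, one in the second `y_k`. -/
theorem statement12 (P : LabeledPoset) :
    genGF (IsEnrichedPPartitionIn (c := P.carrier) sgnT P.lt)
        (fun z => (Sum.map (fun w => (ofLex w).1) (fun w => (ofLex w).1) (ofLex z) :
          ℕ+ ⊕ ℕ+)) =
      ∑ᶠ I ∈ {I : Finset ℕ+ | IsOrderIdeal P I},
        genGF (IsEnrichedPPartitionIn (c := I) sgnPM P.lt)
            (fun w => (Sum.inl (ofLex w).1 : ℕ+ ⊕ ℕ+)) *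
        genGF (IsEnrichedPPartitionIn (c := P.carrier \ I) sgnPM P.lt)
            (fun w => (Sum.inr (ofLex w).1 : ℕ+ ⊕ ℕ+)) := by
  classical
  have hfin : {I : Finset ℕ+ | IsOrderIdeal P I}.Finite :=
    (P.carrier.powerset.finite_toSet).subset fun I hI => by simpa using hI.1
  haveI : Fintype {I : Finset ℕ+ | IsOrderIdeal P I} := hfin.fintype
  rw [← finsum_set_coe_eq_finsum_mem, finsum_eq_sum_of_fintype]
  ext d
  rw [coeff_genGF, map_sum]
  have key := fun I : {I : Finset ℕ+ | IsOrderIdeal P I} =>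
    coeff_mul_genGF (IsEnrichedPPartitionIn (c := I.1) sgnPM P.lt)
      (fun w => (Sum.inl (ofLex w).1 : ℕ+ ⊕ ℕ+))
      (IsEnrichedPPartitionIn (c := P.carrier \ I.1) sgnPM P.lt)
      (fun w => (Sum.inr (ofLex w).1 : ℕ+ ⊕ ℕ+))
      (finite_fiber _ Sum.inl_injective) (finite_fiber _ Sum.inr_injective) d
  rw [Finset.sum_congr rfl fun I _ => (key I).2]
  haveI := fun I => (key I).1
  rw [← Nat.cast_sum, ← Nat.card_sigma]
  congr 1
  symm
  refine Nat.card_congr (Equiv.ofBijective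
    (fun x => ⟨glue P.carrier x.1.1 x.1.2.1 x.2.1, (glue_cond P x.1.1 x.1.2 x.2.1).2 x.2.2.1,
      (glue_content P.carrier x.1.1 x.1.2.1 x.2.1).trans x.2.2.2⟩) ⟨?_, ?_⟩)
  · rintro ⟨⟨I, hI⟩, p, hp⟩ ⟨⟨J, hJ⟩, q, hq⟩ hpq
    have hpq' : glue P.carrier I hI.1 p = glue P.carrier J hJ.1 q := congrArg Subtype.val hpq
    have hIJ : I = J := by
      rw [← leftSet_glue P.carrier I hI.1 p, hpq', leftSet_glue]
    subst hIJ
    have := glue_injective _ _ _ hpq'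
    subst this
    rfl
  · rintro ⟨f, hf, hd⟩
    have hI := leftSet_ideal P f hf
    obtain ⟨p, hp⟩ := exists_glue P.carrier f hI.1
    refine ⟨⟨⟨leftSet f, hI⟩, p, (glue_cond P _ hI p).1 (hp.symm ▸ hf), ?_⟩, Subtype.ext hp⟩
    rw [← glue_content P.carrier (leftSet f) hI.1 p, hp, hd]
end

section
/- Let f_{m,n} denote the number of m-colored peak compositions of n. Then f_{m,1} = m, f_{m,2} = m², and f_{m,n} = m·f_{m,n−1} + f_{m,n−2} for all n > 2. -/
/-- The rainbow decomposition: the maximal runs of constant color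
(color given by `col`) of a list. -/
def runs {β κ : Type*} [DecidableEq κ] (col : β → κ) : List β → List (List β)
  | [] => []
  | a :: rest =>
    match runs col rest with
    | [] => [[a]]
    | b :: bs => if b.head?.map col = some (col a) then (a :: b) :: bs else [a] :: b :: bs

/-- `α` is an `m`-colored composition of `n`: a list of pairs (part, color)
with positive parts summing to `n`. -/
def IsColoredComposition {m : ℕ} (n : ℕ) (α : List (ℕ × Fin m)) : Prop :=
  (∀ p ∈ α, 0 < p.1) ∧ (α.map Prod.fst).sum = n

/-- `α` is an `m`-colored peak composition: every block of its rainbow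
decomposition is a peak composition, i.e. has all parts except possibly the
last one at least `2`. -/
def IsColoredPeakComposition {m : ℕ} (α : List (ℕ × Fin m)) : Prop :=
  ∀ b ∈ runs Prod.snd α, ∀ p ∈ b.dropLast, 2 ≤ p.1

/-- `f_{m,n}`: the number of `m`-colored peak compositions of `n`. -/
noncomputable def fpc (m n : ℕ) : ℕ :=
  Nat.card {α : List (ℕ × Fin m) // IsColoredComposition n α ∧ IsColoredPeakComposition α}

/-- Adjacent-pair form of the peak condition. -/
def Good {m : ℕ} (n : ℕ) (α : List (ℕ × Fin m)) : Prop :=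
  ((∀ p ∈ α, 0 < p.1) ∧ (α.map Prod.fst).sum = n) ∧
    α.IsChain (fun p q => 2 ≤ p.1 ∨ p.2 ≠ q.2)

theorem runs_cons_form {m : ℕ} (a : ℕ × Fin m) (l : List (ℕ × Fin m)) :
    ∃ b bs, runs Prod.snd (a :: l) = (a :: b) :: bs := by
  rw [runs]
  split
  · exact ⟨_, _, rfl⟩
  · split
    · exact ⟨_, _, rfl⟩
    · exact ⟨_, _, rfl⟩

theorem peak_iff {m : ℕ} (α : List (ℕ × Fin m)) :
    IsColoredPeakComposition α ↔ α.IsChain (fun p q => 2 ≤ p.1 ∨ p.2 ≠ q.2) := by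
  induction α with
  | nil => simp [IsColoredPeakComposition, runs]
  | cons a l ih =>
    cases l with
    | nil => simp [IsColoredPeakComposition, runs]
    | cons a' l =>
      rw [List.isChain_cons_cons, ← ih]
      obtain ⟨b, bs, h⟩ := runs_cons_form a' l
      unfold IsColoredPeakComposition
      rw [runs, h]
      by_cases hc : a'.2 = a.2
      · simp [hc, and_assoc, -Prod.forall]
      · have hc' : a.2 ≠ a'.2 := fun h => hc h.symm
        simp [hc, hc']

theorem fpc_eq (m n : ℕ) : fpc m n = Nat.card {α : List (ℕ × Fin m) // Good n α} := by
  unfold fpc Good IsColoredComposition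
  simp only [peak_iff]

/-- Add one to the total, with the first color becoming `c`. -/
def extc {m : ℕ} (c : Fin m) : List (ℕ × Fin m) → List (ℕ × Fin m)
  | [] => [(1, c)]
  | (q, d) :: t => if d = c then (q + 1, c) :: t else (1, c) :: (q, d) :: t

/-- Prepend a part `2` of the same color. -/
def dupc {m : ℕ} : List (ℕ × Fin m) → List (ℕ × Fin m)
  | [] => []
  | (q, d) :: t => (2, d) :: (q, d) :: t

theorem good_ext {m n : ℕ} (c : Fin m) (s : List (ℕ × Fin m)) (h : Good n s) :
    Good (n + 1) (extc c s) := by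
  rcases s with _ | ⟨⟨q, d⟩, t⟩
  · simp [Good, extc] at *; omega
  · obtain ⟨⟨h1, h2⟩, h3⟩ := h
    simp only [List.mem_cons, forall_eq_or_imp, List.map_cons, List.sum_cons] at h1 h2
    simp only [extc]
    split_ifs with hd
    · subst hd
      refine ⟨⟨?_, ?_⟩, ?_⟩
      · simpa using h1.2
      · simp; omega
      · rw [List.isChain_cons] at h3 ⊢
        exact ⟨fun y hy => Or.inl (by simp; omega), h3.2⟩
    · refine ⟨⟨?_, ?_⟩, ?_⟩
      · simpa using h1
      · simp; omega
      · rw [List.isChain_cons_cons]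
        exact ⟨Or.inr (fun h => hd h.symm), h3⟩

theorem good_dup {m n : ℕ} (s : List (ℕ × Fin m)) (h : Good (n + 1) s) :
    Good (n + 3) (dupc s) := by
  rcases s with _ | ⟨⟨q, d⟩, t⟩
  · simp [Good] at h
  · obtain ⟨⟨h1, h2⟩, h3⟩ := h
    simp only [List.mem_cons, forall_eq_or_imp, List.map_cons, List.sum_cons] at h1 h2
    refine ⟨⟨?_, ?_⟩, ?_⟩
    · simpa [dupc] using h1
    · simp [dupc]; omega
    · simp only [dupc]
      rw [List.isChain_cons_cons]
      exact ⟨Or.inl le_rfl, h3⟩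

theorem good_surj {m n : ℕ} (α : List (ℕ × Fin m)) (h : Good (n + 1) α) :
    (∃ c s, Good n s ∧ extc c s = α) ∨ (∃ k s, n = k + 2 ∧ Good (k + 1) s ∧ dupc s = α) := by
  rcases α with _ | ⟨⟨p, c⟩, t⟩
  · simp [Good] at h
  obtain ⟨⟨h1, h2⟩, h3⟩ := h
  simp only [List.mem_cons, forall_eq_or_imp, List.map_cons, List.sum_cons] at h1 h2
  obtain ⟨hp, ht⟩ := h1
  obtain _ | _ | _ | p := p
  · simp at hp
  · left
    refine ⟨c, t, ⟨⟨ht, by simp at h2; omega⟩, h3.tail⟩, ?_⟩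
    rcases t with _ | ⟨⟨q, d⟩, t⟩
    · rfl
    · rw [List.isChain_cons_cons] at h3
      have : d ≠ c := by simpa [eq_comm] using h3.1
      simp [extc, this]
  · rcases t with _ | ⟨⟨q, d⟩, t⟩
    · left
      refine ⟨c, [(1, c)], ?_, by simp [extc]⟩
      simp [Good] at h2 ⊢
      omega
    · by_cases hd : d = c
      · right
        subst hd
        have hq := ht (q, d) (by simp)
        simp at h2 hq
        refine ⟨n - 2, (q, d) :: t, by omega, ⟨⟨ht, by simp; omega⟩, h3.tail⟩, rfl⟩
      · left
        refine ⟨c, (1, c) :: (q, d) :: t, ⟨⟨?_, ?_⟩, ?_⟩, by simp [extc]⟩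
        · simpa using ht
        · simp at h2 ⊢; omega
        · rw [List.isChain_cons_cons]
          exact ⟨Or.inr (fun h => hd h.symm), h3.tail⟩
  · left
    refine ⟨c, (p + 2, c) :: t, ⟨⟨?_, ?_⟩, ?_⟩, by simp [extc]⟩
    · simpa using ht
    · simp at h2 ⊢; omega
    · rw [List.isChain_cons] at h3 ⊢
      exact ⟨fun y hy => Or.inl (by simp), h3.2⟩

theorem ext_inj {m n : ℕ} {c c' : Fin m} {s s' : List (ℕ × Fin m)} (h : Good n s)
    (h' : Good n s') (e : extc c s = extc c' s') : c = c' ∧ s = s' := by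
  rcases s with _ | ⟨⟨q, d⟩, t⟩ <;> rcases s' with _ | ⟨⟨q', d'⟩, t'⟩
  · simpa [extc] using e
  · have := h'.1.1 (q', d') (by simp)
    simp [Good] at h h'
    omega
  · have := h.1.1 (q, d) (by simp)
    simp [Good] at h h'
    omega
  · have := h.1.1 (q, d) (by simp)
    have := h'.1.1 (q', d') (by simp)
    simp only [extc] at e
    split_ifs at e <;> grind

theorem ext_ne_dup {m n k : ℕ} {c : Fin m} {s s' : List (ℕ × Fin m)} (h : Good n s)
    (h' : Good (k + 1) s') (e : extc c s = dupc s') : False := by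
  rcases s' with _ | ⟨⟨q', d'⟩, t'⟩
  · simp [Good] at h'
  rcases s with _ | ⟨⟨q, d⟩, t⟩
  · simp [extc, dupc] at e
  · simp only [extc, dupc] at e
    split_ifs at e with hd
    · simp at e
      obtain ⟨⟨hq, hc⟩, ht⟩ := e
      subst ht
      have := h.2
      rw [List.isChain_cons_cons] at this
      have := this.1
      simp at this
      grind
    · simp at e

theorem dup_inj {m n : ℕ} {s s' : List (ℕ × Fin m)} (h : Good (n + 1) s)
    (h' : Good (n + 1) s') (e : dupc s = dupc s') : s = s' := by
  rcases s with _ | ⟨⟨q, d⟩, t⟩ 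
  · simp [Good] at h
  rcases s' with _ | ⟨⟨q', d'⟩, t'⟩
  · simp [Good] at h'
  simp [dupc] at e
  grind

/-- Small step map. -/
def stepA {m n : ℕ} (x : Fin m × {α : List (ℕ × Fin m) // Good n α}) :
    {α : List (ℕ × Fin m) // Good (n + 1) α} :=
  ⟨extc x.1 x.2.1, good_ext _ _ x.2.2⟩

/-- Full step map. -/
def stepB {m n : ℕ} : (Fin m × {α : List (ℕ × Fin m) // Good (n + 2) α}) ⊕
      {α : List (ℕ × Fin m) // Good (n + 1) α} → {α : List (ℕ × Fin m) // Good (n + 3) α}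
  | Sum.inl x => stepA x
  | Sum.inr s => ⟨dupc s.1, good_dup _ s.2⟩

theorem stepA_inj {m n : ℕ} : Function.Injective (stepA (m := m) (n := n)) := by
  rintro ⟨c, s, h⟩ ⟨c', s', h'⟩ e
  obtain ⟨rfl, rfl⟩ := ext_inj h h' (congrArg Subtype.val e)
  rfl

theorem stepA_bij {m n : ℕ} (hn : n < 2) : Function.Bijective (stepA (m := m) (n := n)) := by
  refine ⟨stepA_inj, ?_⟩
  rintro ⟨α, h⟩
  rcases good_surj α h with ⟨c, s, hs, e⟩ | ⟨k, s, hk, _⟩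
  · exact ⟨(c, ⟨s, hs⟩), Subtype.ext e⟩
  · omega

theorem stepB_bij {m n : ℕ} : Function.Bijective (stepB (m := m) (n := n)) := by
  constructor
  · rintro (x | ⟨s, h⟩) (y | ⟨s', h'⟩) e
    · exact congrArg Sum.inl (stepA_inj e)
    · exact (ext_ne_dup x.2.2 h' (congrArg Subtype.val e)).elim
    · exact (ext_ne_dup y.2.2 h (congrArg Subtype.val e).symm).elim
    · obtain rfl := dup_inj h h' (congrArg Subtype.val e)
      rfl
  · rintro ⟨α, h⟩
    rcases good_surj α h with ⟨c, s, hs, e⟩ | ⟨k, s, hk, hs, e⟩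
    · exact ⟨Sum.inl (c, ⟨s, hs⟩), Subtype.ext e⟩
    · obtain rfl : n = k := by omega
      exact ⟨Sum.inr ⟨s, hs⟩, Subtype.ext e⟩

theorem good_zero {m : ℕ} (α : List (ℕ × Fin m)) : Good 0 α ↔ α = [] := by
  constructor
  · intro h
    rcases α with _ | ⟨⟨q, d⟩, t⟩
    · rfl
    · have := h.1.1 (q, d) (by simp)
      have := h.1.2
      simp at this
      grind
  · rintro rfl
    simp [Good]

theorem card_zero' (m : ℕ) : Nat.card {α : List (ℕ × Fin m) // Good 0 α} = 1 := by
  simp [good_zero]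

theorem good_finite (m n : ℕ) : Finite {α : List (ℕ × Fin m) // Good n α} ∧
    Finite {α : List (ℕ × Fin m) // Good (n + 1) α} ∧
    Finite {α : List (ℕ × Fin m) // Good (n + 2) α} := by
  induction n with
  | zero =>
    have h0 : Finite {α : List (ℕ × Fin m) // Good 0 α} :=
      Nat.finite_of_card_ne_zero (by rw [card_zero']; simp)
    have h1 : Finite {α : List (ℕ × Fin m) // Good (0 + 1) α} :=
      Finite.of_surjective _ (stepA_bij (by norm_num)).2
    exact ⟨h0, h1, Finite.of_surjective _ (stepA_bij (n := 0 + 1) (by norm_num)).2⟩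
  | succ n ih =>
    obtain ⟨h0, h1, h2⟩ := ih
    exact ⟨h1, h2, Finite.of_surjective _ stepB_bij.2⟩

/-- `f_{m,1} = m`, `f_{m,2} = m²` and `f_{m,n} = m·f_{m,n−1} + f_{m,n−2}`
for `n > 2`. -/
theorem statement17 (m : ℕ) (hm : 1 ≤ m) :
    fpc m 1 = m ∧ fpc m 2 = m ^ 2 ∧
      ∀ n, 2 < n → fpc m n = m * fpc m (n - 1) + fpc m (n - 2) := by
  have e1 : fpc m 1 = m := by
    rw [fpc_eq, ← Nat.card_congr (Equiv.ofBijective _ (stepA_bij (n := 0) (by norm_num))),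
      Nat.card_prod, card_zero']
    simp
  refine ⟨e1, ?_, ?_⟩
  · rw [fpc_eq, ← Nat.card_congr (Equiv.ofBijective _ (stepA_bij (n := 1) (by norm_num))),
      Nat.card_prod, ← fpc_eq, e1]
    simp [sq]
  · intro n hn
    obtain ⟨k, rfl⟩ : ∃ k, n = k + 3 := ⟨n - 3, by omega⟩
    obtain ⟨_, h1, h2⟩ := good_finite m k
    rw [fpc_eq, ← Nat.card_congr (Equiv.ofBijective _ (stepB_bij (n := k))),
      Nat.card_sum, Nat.card_prod, ← fpc_eq, ← fpc_eq]
    simp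
end
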